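/- All-zero column exclusion for equivocation (Theorem 2): if q ∈ Δ is a local minimizer of the function q ↦ l(q) relative to the set Δ (i.e., IsLocalMinOn l Δ q), then q(0) = 0, where 0 denotes the zero vector of W. -/

import Mathlib

attribute [local instance] Classical.propDecidable

noncomputable instance {κ : ℕ} : Fintype (Submodule (ZMod 2) (Fin κ → ZMod 2)) :=
  haveI : Finite (Submodule (ZMod 2) (Fin κ → ZMod 2)) :=
    Finite.of_injective (fun S => (S : Set (Fin κ → ZMod 2))) SetLike.coe_injective
  Fintype.ofFinite _

/-- `ζ(S,q)`: the sum of `q v` over the vectors `v` lying in the subspace `S`. -/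
noncomputable def zeta (κ : ℕ) (S : Submodule (ZMod 2) (Fin κ → ZMod 2))
    (q : (Fin κ → ZMod 2) → ℝ) : ℝ :=
  ∑ v : Fin κ → ZMod 2, if v ∈ S then q v else 0

/-- The feasible simplex `Δ` of code-definition vectors. -/
def simplex (κ : ℕ) : Set ((Fin κ → ZMod 2) → ℝ) :=
  {q | (∀ v, 0 ≤ q v) ∧ ∑ v, q v = 1}

/-- The expected equivocation loss
`l(q) = n(1−ε) − κ + Σ_{δ=1}^{κ} K_δ Σ_{dim S = κ−δ} ε^{n(1−ζ(S,q))}`,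
where `K_δ = ∏_{i=1}^{δ−1} (1 − 2^i)` and the power is the real power. -/
noncomputable def eqLoss (κ n : ℕ) (ε : ℝ) (q : (Fin κ → ZMod 2) → ℝ) : ℝ :=
  (n : ℝ) * (1 - ε) - (κ : ℝ) +
    ∑ δ ∈ Finset.Icc 1 κ,
      (∏ i ∈ Finset.Icc 1 (δ - 1), (1 - (2 : ℝ) ^ i)) *
        ∑ S ∈ Finset.univ.filter
            (fun S : Submodule (ZMod 2) (Fin κ → ZMod 2) =>
              Module.finrank (ZMod 2) S = κ - δ),
          ε ^ ((n : ℝ) * (1 - zeta κ S q))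

/-- The coefficient `K_d = ∏_{i=1}^{d-1} (1 - 2^i)`. -/
noncomputable def lossCoeff (d : ℕ) : ℝ := ∏ i ∈ Finset.Icc 1 (d - 1), (1 - (2 : ℝ) ^ i)

lemma lossCoeff_one : lossCoeff 1 = 1 := by simp [lossCoeff]

lemma lossCoeff_add_two (d : ℕ) :
    lossCoeff (d + 2) = (1 - (2 : ℝ) ^ (d + 1)) * lossCoeff (d + 1) := by
  simp only [lossCoeff, show d + 2 - 1 = d + 1 by omega, show d + 1 - 1 = d by omega]
  rw [Finset.prod_Icc_succ_top (by omega), mul_comm]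

section Subspaces

variable {κ : ℕ}

lemma card_filter_mem_submodule (R : Submodule (ZMod 2) (Fin κ → ZMod 2)) :
    (Finset.univ.filter fun w => w ∈ R).card = 2 ^ Module.finrank (ZMod 2) R := by
  rw [← Fintype.card_subtype]
  simpa only [ZMod.card] using Module.card_eq_pow_finrank (K := ZMod 2) (V := R)

lemma finrank_ker_add_one {φ : (Fin κ → ZMod 2) →ₗ[ZMod 2] ZMod 2} {v : Fin κ → ZMod 2}
    (hv : φ v = 1) : Module.finrank (ZMod 2) (LinearMap.ker φ) + 1 = κ := by
  have h := LinearMap.finrank_range_add_finrank_ker φ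
  have hr : LinearMap.range φ = ⊤ := by
    refine LinearMap.range_eq_top.2 fun c => ⟨c • v, by simp [hv]⟩
  rw [hr, finrank_top, Module.finrank_self, Module.finrank_fin_fun] at h
  omega

/-- A subspace meeting the complement of the hyperplane `ker φ` is spanned by its trace on the
hyperplane together with any one of its vectors off the hyperplane. -/
lemma inf_ker_sup_span_singleton {φ : (Fin κ → ZMod 2) →ₗ[ZMod 2] ZMod 2}
    {S : Submodule (ZMod 2) (Fin κ → ZMod 2)} {w : Fin κ → ZMod 2} (hwS : w ∈ S)
    (hw : φ w = 1) : S ⊓ LinearMap.ker φ ⊔ Submodule.span (ZMod 2) {w} = S := by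
  refine le_antisymm (sup_le inf_le_left (by simpa using hwS)) fun s hs => ?_
  refine Submodule.mem_sup.2 ⟨s - φ s • w, ⟨S.sub_mem hs (S.smul_mem _ hwS), ?_⟩, φ s • w,
    Submodule.smul_mem _ _ (Submodule.mem_span_singleton_self w), by simp⟩
  simp [hw]

lemma sup_span_singleton_inf_ker {φ : (Fin κ → ZMod 2) →ₗ[ZMod 2] ZMod 2}
    {R : Submodule (ZMod 2) (Fin κ → ZMod 2)} (hR : R ≤ LinearMap.ker φ) {w : Fin κ → ZMod 2}
    (hw : φ w = 1) : (R ⊔ Submodule.span (ZMod 2) {w}) ⊓ LinearMap.ker φ = R := by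
  refine le_antisymm ?_ (le_inf le_sup_left hR)
  rintro s ⟨hs, hsφ⟩
  obtain ⟨r, hr, c, rfl⟩ := by simpa [Submodule.mem_sup, Submodule.mem_span_singleton] using hs
  have h0 : φ r = 0 := hR hr
  have : c = 0 := by simpa [h0, hw] using hsφ
  simpa [this] using hr

lemma finrank_inf_ker_add_one {φ : (Fin κ → ZMod 2) →ₗ[ZMod 2] ZMod 2}
    {S : Submodule (ZMod 2) (Fin κ → ZMod 2)} {w : Fin κ → ZMod 2} (hwS : w ∈ S)
    (hw : φ w = 1) :
    Module.finrank (ZMod 2) ↥(S ⊓ LinearMap.ker φ) + 1 = Module.finrank (ZMod 2) S := by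
  have h : w ∉ S ⊓ LinearMap.ker φ := fun h => by
    have : φ w = 0 := h.2
    simp [hw] at this
  rw [← Submodule.finrank_sup_span_singleton h, inf_ker_sup_span_singleton hwS hw]

lemma exists_mem_apply_eq_one {φ : (Fin κ → ZMod 2) →ₗ[ZMod 2] ZMod 2}
    {S : Submodule (ZMod 2) (Fin κ → ZMod 2)} (hS : ¬ S ≤ LinearMap.ker φ) :
    ∃ w ∈ S, φ w = 1 := by
  obtain ⟨w, hw, hφ⟩ := SetLike.not_le_iff_exists.1 hS
  exact ⟨w, hw, (Fin.eq_one_of_ne_zero _ hφ :)⟩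

/-- The number of subspaces `S` off the hyperplane `ker φ` with trace `R` that avoid a given vector
`v` off the hyperplane, times the size of `R`, is `|ker φ| - |R|`. -/
lemma card_subspaces_with_trace {φ : (Fin κ → ZMod 2) →ₗ[ZMod 2] ZMod 2} {v : Fin κ → ZMod 2}
    (hv : φ v = 1) {R : Submodule (ZMod 2) (Fin κ → ZMod 2)} (hR : R ≤ LinearMap.ker φ) :
    (Finset.univ.filter fun S : Submodule (ZMod 2) (Fin κ → ZMod 2) =>
        (v ∉ S ∧ ¬ S ≤ LinearMap.ker φ) ∧ S ⊓ LinearMap.ker φ = R).card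
        * 2 ^ Module.finrank (ZMod 2) R + 2 ^ Module.finrank (ZMod 2) R
      = 2 ^ Module.finrank (ZMod 2) (LinearMap.ker φ) := by
  set Φ := Finset.univ.filter fun S : Submodule (ZMod 2) (Fin κ → ZMod 2) =>
    (v ∉ S ∧ ¬ S ≤ LinearMap.ker φ) ∧ S ⊓ LinearMap.ker φ = R with hΦ
  set D := (Finset.univ.filter fun w => w ∈ LinearMap.ker φ) \
    (Finset.univ.filter fun w => w ∈ R) with hD
  have hDcard : D.card + 2 ^ Module.finrank (ZMod 2) R
      = 2 ^ Module.finrank (ZMod 2) (LinearMap.ker φ) := by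
    rw [← card_filter_mem_submodule, ← card_filter_mem_submodule]
    exact Finset.card_sdiff_add_card_eq_card
      (Finset.monotone_filter_right _ fun w _ hw => hR hw)
  rw [← hDcard]
  congr 1
  have hmaps : Set.MapsTo (fun h => R ⊔ Submodule.span (ZMod 2) {v + h}) (D : Set _) Φ := by
    intro h hh
    simp only [hD, Finset.coe_sdiff, Finset.coe_filter, Finset.mem_univ, true_and, Set.mem_sdiff,
      Set.mem_ofPred_eq, LinearMap.mem_ker] at hh
    have hw : φ (v + h) = 1 := by simp [hv, hh.1]
    have hinf := sup_span_singleton_inf_ker hR hw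
    have hmem : v + h ∈ R ⊔ Submodule.span (ZMod 2) {v + h} :=
      Submodule.mem_sup_right (Submodule.mem_span_singleton_self _)
    simp only [hΦ, Finset.coe_filter, Finset.mem_univ, true_and, Set.mem_ofPred_eq]
    refine ⟨⟨fun hvS => hh.2 ?_, fun hle => ?_⟩, hinf⟩
    · rw [← hinf]
      exact ⟨by simpa using Submodule.sub_mem _ hmem hvS, hh.1⟩
    · have : φ (v + h) = 0 := hle hmem
      simp [hw] at this
  rw [Finset.card_eq_sum_card_fiberwise hmaps, ← smul_eq_mul, ← Finset.sum_const]
  refine Finset.sum_congr rfl fun S hS => ?_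
  simp only [hΦ, Finset.mem_filter, Finset.mem_univ, true_and] at hS
  obtain ⟨⟨hvS, hSk⟩, hSR⟩ := hS
  obtain ⟨s, hs, hsφ⟩ := exists_mem_apply_eq_one hSk
  rw [← card_filter_mem_submodule]
  refine Finset.card_bij (fun r _ => r + (s - v)) ?_ (fun _ _ _ _ h => by simpa using h) ?_
  · intro r hr
    have hr : r ∈ R := by simpa using hr
    have hrS : r ∈ S := (hSR ▸ hr : r ∈ S ⊓ LinearMap.ker φ).1
    have hrφ : φ r = 0 := hR hr
    have e : v + (r + (s - v)) = r + s := by abel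
    simp only [hD, Finset.mem_filter, Finset.mem_sdiff, Finset.mem_univ, true_and,
      LinearMap.mem_ker, e]
    refine ⟨⟨by simp [hrφ, hsφ, hv], fun hmem => hvS ?_⟩, ?_⟩
    · have h1 : r + (s - v) ∈ S := (hSR ▸ hmem : r + (s - v) ∈ S ⊓ LinearMap.ker φ).1
      have h2 := S.sub_mem (S.add_mem hrS hs) h1
      rwa [show r + s - (r + (s - v)) = v by abel] at h2
    · subst hSR
      exact inf_ker_sup_span_singleton (S.add_mem hrS hs) (by simp [hrφ, hsφ])
  · intro h hh
    simp only [hD, Finset.mem_filter, Finset.mem_sdiff, Finset.mem_univ, true_and,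
      LinearMap.mem_ker] at hh
    obtain ⟨⟨hhφ, -⟩, hhS⟩ := hh
    have hmem : v + h ∈ S := by
      rw [← hhS]
      exact Submodule.mem_sup_right (Submodule.mem_span_singleton_self _)
    refine ⟨v + h - s, ?_, by abel⟩
    simp only [Finset.mem_filter, Finset.mem_univ, true_and, ← hSR]
    exact ⟨S.sub_mem hmem hs, by simp [hhφ, hv, hsφ]⟩

lemma sum_lossCoeff_with_trace {φ : (Fin κ → ZMod 2) →ₗ[ZMod 2] ZMod 2} {v : Fin κ → ZMod 2}
    (hv : φ v = 1) {R : Submodule (ZMod 2) (Fin κ → ZMod 2)} (hR : R ≤ LinearMap.ker φ) :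
    ∑ S ∈ Finset.univ.filter (fun S : Submodule (ZMod 2) (Fin κ → ZMod 2) =>
        v ∉ S ∧ S ⊓ LinearMap.ker φ = R), lossCoeff (κ - Module.finrank (ZMod 2) S)
      = if R = LinearMap.ker φ then 1 else 0 := by
  set H := LinearMap.ker φ with hH
  have hκ : Module.finrank (ZMod 2) H + 1 = κ := finrank_ker_add_one hv
  have hvH : v ∉ H := fun h => by
    have : φ v = 0 := h
    simp [hv] at this
  have hcard := card_subspaces_with_trace hv hR
  rw [← Finset.sum_filter_add_sum_filter_not _ (fun S => S ≤ H), Finset.filter_filter,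
    Finset.filter_filter]
  have h1 : (Finset.univ.filter fun S : Submodule (ZMod 2) (Fin κ → ZMod 2) =>
      (v ∉ S ∧ S ⊓ H = R) ∧ S ≤ H) = {R} := by
    ext S
    simp only [Finset.mem_filter, Finset.mem_univ, true_and, Finset.mem_singleton]
    constructor
    · rintro ⟨⟨-, h⟩, hle⟩
      rwa [inf_eq_left.2 hle] at h
    · rintro rfl
      exact ⟨⟨fun h => hvH (hR h), inf_eq_left.2 hR⟩, hR⟩
  have h2 : (Finset.univ.filter fun S : Submodule (ZMod 2) (Fin κ → ZMod 2) =>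
      (v ∉ S ∧ S ⊓ H = R) ∧ ¬ S ≤ H) = Finset.univ.filter fun S =>
      (v ∉ S ∧ ¬ S ≤ H) ∧ S ⊓ H = R := by
    ext S
    simp only [Finset.mem_filter, Finset.mem_univ, true_and]
    tauto
  have h3 : ∀ S ∈ Finset.univ.filter (fun S : Submodule (ZMod 2) (Fin κ → ZMod 2) =>
      (v ∉ S ∧ ¬ S ≤ H) ∧ S ⊓ H = R), lossCoeff (κ - Module.finrank (ZMod 2) S)
      = lossCoeff (κ - (Module.finrank (ZMod 2) R + 1)) := by
    intro S hS
    simp only [Finset.mem_filter, Finset.mem_univ, true_and] at hS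
    obtain ⟨s, hs, hsφ⟩ := exists_mem_apply_eq_one hS.1.2
    rw [← finrank_inf_ker_add_one hs hsφ, ← hH, hS.2]
  rw [h1, h2, Finset.sum_singleton, Finset.sum_congr rfl h3, Finset.sum_const, nsmul_eq_mul]
  set N := (Finset.univ.filter fun S : Submodule (ZMod 2) (Fin κ → ZMod 2) =>
    (v ∉ S ∧ ¬ S ≤ H) ∧ S ⊓ H = R).card
  split_ifs with hRH
  · have hN : N = 0 := by
      rw [hRH, ← hH] at hcard
      simpa using hcard
    rw [hN, hRH, show κ - Module.finrank (ZMod 2) H = 1 by omega, lossCoeff_one]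
    simp
  · have hlt := Submodule.finrank_lt_finrank_of_lt (lt_of_le_of_ne hR hRH)
    obtain ⟨d, hd⟩ := Nat.exists_eq_add_of_lt hlt
    rw [show κ - Module.finrank (ZMod 2) R = d + 2 by omega,
      show κ - (Module.finrank (ZMod 2) R + 1) = d + 1 by omega, lossCoeff_add_two]
    have hN : N + 1 = 2 ^ (d + 1) := by
      rw [hd, add_assoc, pow_add] at hcard
      refine Nat.eq_of_mul_eq_mul_left (pow_pos two_pos (Module.finrank (ZMod 2) R)) ?_
      rw [← hcard]
      ring
    have hN' : (N : ℝ) + 1 = 2 ^ (d + 1) := by exact_mod_cast hN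
    rw [← hN']
    ring

/-- The coefficients of the subspaces that contain `T` and avoid a vector `v ∉ T` sum to one. -/
lemma sum_lossCoeff_avoiding {T : Submodule (ZMod 2) (Fin κ → ZMod 2)} {v : Fin κ → ZMod 2}
    (hvT : v ∉ T) :
    ∑ S ∈ Finset.univ.filter (fun S : Submodule (ZMod 2) (Fin κ → ZMod 2) => v ∉ S ∧ T ≤ S),
      lossCoeff (κ - Module.finrank (ZMod 2) S) = 1 := by
  obtain ⟨φ, hφ, hTφ⟩ := Submodule.exists_le_ker_of_notMem hvT
  have hv : φ v = 1 := (Fin.eq_one_of_ne_zero _ hφ :)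
  rw [← Finset.sum_fiberwise_of_maps_to (g := fun S => S ⊓ LinearMap.ker φ)
    (t := Finset.univ.filter fun R => T ≤ R ∧ R ≤ LinearMap.ker φ)]
  · have h : ∀ R ∈ Finset.univ.filter (fun R : Submodule (ZMod 2) (Fin κ → ZMod 2) =>
        T ≤ R ∧ R ≤ LinearMap.ker φ),
        ∑ S ∈ (Finset.univ.filter (fun S : Submodule (ZMod 2) (Fin κ → ZMod 2) =>
          v ∉ S ∧ T ≤ S)).filter (fun S => S ⊓ LinearMap.ker φ = R),
          lossCoeff (κ - Module.finrank (ZMod 2) S)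
        = if R = LinearMap.ker φ then 1 else 0 := by
      intro R hR
      simp only [Finset.mem_filter, Finset.mem_univ, true_and] at hR
      rw [← sum_lossCoeff_with_trace hv hR.2, Finset.filter_filter]
      refine Finset.sum_congr (Finset.filter_congr fun S _ => ?_) fun _ _ => rfl
      constructor
      · rintro ⟨⟨h1, -⟩, h2⟩
        exact ⟨h1, h2⟩
      · rintro ⟨h1, h2⟩
        exact ⟨⟨h1, hR.1.trans (h2 ▸ inf_le_left)⟩, h2⟩
    rw [Finset.sum_congr rfl h]
    simp [hTφ]
  · intro S hS
    simp only [Finset.mem_filter, Finset.mem_univ, true_and] at hS ⊢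
    exact ⟨le_inf hS.2 hTφ, inf_le_right⟩

/-- The weighted sum of products over the subspaces avoiding a nonzero vector is positive when all
factors are at least one. -/
lemma sum_lossCoeff_mul_prod_pos {v : Fin κ → ZMod 2} (hv : v ≠ 0) {x : (Fin κ → ZMod 2) → ℝ}
    (hx : ∀ w, 0 ≤ x w) :
    0 < ∑ S ∈ Finset.univ.filter (fun S : Submodule (ZMod 2) (Fin κ → ZMod 2) => v ∉ S),
      lossCoeff (κ - Module.finrank (ZMod 2) S)
        * ∏ w ∈ Finset.univ.filter (fun w => w ∈ S), (1 + x w) := by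
  have hexp : ∀ S : Submodule (ZMod 2) (Fin κ → ZMod 2),
      ∏ w ∈ Finset.univ.filter (fun w => w ∈ S), (1 + x w)
        = ∑ A : Finset (Fin κ → ZMod 2),
          if Submodule.span (ZMod 2) (A : Set _) ≤ S then ∏ w ∈ A, x w else 0 := by
    intro S
    rw [Finset.prod_one_add, ← Finset.sum_filter]
    refine Finset.sum_congr ?_ fun _ _ => rfl
    ext A
    simp [Submodule.span_le, Finset.subset_iff, Set.subset_def]
  simp_rw [hexp, Finset.mul_sum, mul_ite, mul_zero]
  rw [Finset.sum_comm]
  have hterm : ∀ A : Finset (Fin κ → ZMod 2),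
      (∑ S ∈ Finset.univ.filter (fun S : Submodule (ZMod 2) (Fin κ → ZMod 2) => v ∉ S),
        if Submodule.span (ZMod 2) (A : Set _) ≤ S then
          lossCoeff (κ - Module.finrank (ZMod 2) S) * ∏ w ∈ A, x w else 0)
      = if v ∈ Submodule.span (ZMod 2) (A : Set _) then 0 else ∏ w ∈ A, x w := by
    intro A
    rw [← Finset.sum_filter, Finset.filter_filter, ← Finset.sum_mul]
    split_ifs with h
    · rw [Finset.filter_false_of_mem fun S _ hS => hS.1 (hS.2 h)]
      simp
    · rw [sum_lossCoeff_avoiding h, one_mul]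
  simp_rw [hterm]
  refine Finset.sum_pos' (fun A _ => ?_) ⟨∅, Finset.mem_univ _, ?_⟩
  · split_ifs
    exacts [le_rfl, Finset.prod_nonneg fun w _ => hx w]
  · simp [hv]

end Subspaces

lemma eqLoss_eq_sum (κ n : ℕ) (ε : ℝ) (q : (Fin κ → ZMod 2) → ℝ) :
    eqLoss κ n ε q = (n : ℝ) * (1 - ε) - κ +
      ∑ S ∈ Finset.univ.filter
          (fun S : Submodule (ZMod 2) (Fin κ → ZMod 2) => Module.finrank (ZMod 2) S < κ),
        lossCoeff (κ - Module.finrank (ZMod 2) S) * ε ^ ((n : ℝ) * (1 - zeta κ S q)) := by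
  rw [eqLoss]
  congr 1
  rw [← Finset.sum_fiberwise_of_maps_to
    (g := fun S : Submodule (ZMod 2) (Fin κ → ZMod 2) => κ - Module.finrank (ZMod 2) S)
    (t := Finset.Icc 1 κ)]
  · refine Finset.sum_congr rfl fun δ hδ => ?_
    rw [Finset.mem_Icc] at hδ
    rw [Finset.mul_sum, Finset.filter_filter]
    refine Finset.sum_congr (Finset.filter_congr fun S _ => by omega) fun S hS => ?_
    rw [← (Finset.mem_filter.1 hS).2.2, lossCoeff]
  · intro S hS
    have := (Finset.mem_filter.1 hS).2
    rw [Finset.mem_Icc]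
    omega

/-- Moving mass `t` from the zero vector to a nonzero vector `v` changes the loss by a factor
`ε ^ (n t)` on the part coming from the subspaces avoiding `v`. -/
lemma eqLoss_add_smul {κ n : ℕ} {ε : ℝ} (hε0 : 0 < ε) (q : (Fin κ → ZMod 2) → ℝ)
    (v : Fin κ → ZMod 2) (t : ℝ) :
    eqLoss κ n ε (q + t • (Pi.single v 1 - Pi.single 0 1)) = eqLoss κ n ε q +
      (ε ^ ((n : ℝ) * t) - 1) * ∑ S ∈ Finset.univ.filter
        (fun S : Submodule (ZMod 2) (Fin κ → ZMod 2) => v ∉ S),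
        lossCoeff (κ - Module.finrank (ZMod 2) S) * ε ^ ((n : ℝ) * (1 - zeta κ S q)) := by
  have hzeta : ∀ S : Submodule (ZMod 2) (Fin κ → ZMod 2),
      zeta κ S (q + t • (Pi.single v 1 - Pi.single 0 1))
        = zeta κ S q + t * ((if v ∈ S then 1 else 0) - 1) := by
    intro S
    simp only [zeta, ← Finset.sum_filter, Pi.add_apply, Pi.smul_apply, Pi.sub_apply, smul_eq_mul,
      Finset.sum_add_distrib, ← Finset.mul_sum, Finset.sum_sub_distrib]
    simp
  have hsub : (Finset.univ.filter
        (fun S : Submodule (ZMod 2) (Fin κ → ZMod 2) => v ∉ S))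
      = (Finset.univ.filter (fun S : Submodule (ZMod 2) (Fin κ → ZMod 2) =>
        Module.finrank (ZMod 2) S < κ)).filter (fun S => v ∉ S) := by
    rw [Finset.filter_filter]
    refine Finset.filter_congr fun S _ => ⟨fun h => ⟨?_, h⟩, fun h => h.2⟩
    have := Submodule.finrank_lt (s := S) fun hS => h (hS ▸ Submodule.mem_top)
    rwa [Module.finrank_fin_fun] at this
  rw [eqLoss_eq_sum, eqLoss_eq_sum, add_assoc, hsub,
    Finset.sum_filter (fun S : Submodule (ZMod 2) (Fin κ → ZMod 2) => v ∉ S),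
    Finset.mul_sum, ← Finset.sum_add_distrib]
  congr 1
  refine Finset.sum_congr rfl fun S _ => ?_
  rw [hzeta]
  split_ifs
  · simp
  · rw [show (n : ℝ) * (1 - (zeta κ S q + t * (0 - 1)))
      = n * (1 - zeta κ S q) + n * t by ring, Real.rpow_add hε0]
    ring

lemma rpow_one_sub_zeta {κ n : ℕ} {ε : ℝ} (hε0 : 0 < ε) (q : (Fin κ → ZMod 2) → ℝ)
    (S : Submodule (ZMod 2) (Fin κ → ZMod 2)) :
    ε ^ ((n : ℝ) * (1 - zeta κ S q)) = ε ^ (n : ℝ) *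
      ∏ w ∈ Finset.univ.filter (fun w => w ∈ S), ε ^ (-((n : ℝ) * q w)) := by
  rw [← Real.rpow_sum_of_pos hε0, ← Real.rpow_add hε0, zeta, ← Finset.sum_filter,
    Finset.sum_neg_distrib, ← Finset.mul_sum]
  ring_nf

/-- Theorem 2: a local minimizer of the equivocation loss on the simplex assigns
zero weight to the all-zero column. -/
theorem zero_column_exclusion (κ n : ℕ) (hκ : 1 ≤ κ) (hn : 1 ≤ n)
    (ε : ℝ) (hε0 : 0 < ε) (hε1 : ε < 1)
    (q : (Fin κ → ZMod 2) → ℝ) (hq : q ∈ simplex κ)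
    (hmin : IsLocalMinOn (eqLoss κ n ε) (simplex κ) q) :
    q 0 = 0 := by
  by_contra hq0
  have hq0 : 0 < q 0 := lt_of_le_of_ne (hq.1 0) (Ne.symm hq0)
  obtain ⟨v, hv⟩ : ∃ v : Fin κ → ZMod 2, v ≠ 0 :=
    haveI : Nonempty (Fin κ) := ⟨⟨0, hκ⟩⟩
    exists_ne 0
  have hn0 : (0 : ℝ) < n := by exact_mod_cast hn
  have hD : 0 < ∑ S ∈ Finset.univ.filter
      (fun S : Submodule (ZMod 2) (Fin κ → ZMod 2) => v ∉ S),
      lossCoeff (κ - Module.finrank (ZMod 2) S) * ε ^ ((n : ℝ) * (1 - zeta κ S q)) := by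
    have h := sum_lossCoeff_mul_prod_pos hv (x := fun w => ε ^ (-((n : ℝ) * q w)) - 1) fun w =>
      sub_nonneg.2 (Real.one_le_rpow_of_pos_of_le_one_of_nonpos hε0 hε1.le
        (neg_nonpos.2 (mul_nonneg hn0.le (hq.1 w))))
    simp only [add_sub_cancel] at h
    have h' := mul_pos (Real.rpow_pos_of_pos hε0 (n : ℝ)) h
    rw [Finset.mul_sum] at h'
    refine h'.trans_eq (Finset.sum_congr rfl fun S _ => ?_)
    rw [rpow_one_sub_zeta hε0]
    ring
  let p : ℝ → (Fin κ → ZMod 2) → ℝ := fun t => q + t • (Pi.single v 1 - Pi.single 0 1)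
  have hp : Continuous p := by fun_prop
  have hp0 : Filter.Tendsto p (nhdsWithin 0 (Set.Ioo 0 (q 0))) (nhdsWithin q (simplex κ)) := by
    refine tendsto_nhdsWithin_iff.2 ⟨?_, ?_⟩
    · have h := hp.tendsto 0
      simp only [p, zero_smul, add_zero] at h
      exact h.mono_left nhdsWithin_le_nhds
    · filter_upwards [self_mem_nhdsWithin] with t ht
      refine ⟨fun w => ?_, ?_⟩
      · have h1 : (0 : ℝ) ≤ (Pi.single v 1 : (Fin κ → ZMod 2) → ℝ) w := by
          rw [Pi.single_apply]
          split_ifs <;> norm_num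
        have h2 := mul_nonneg ht.1.le h1
        simp only [p, Pi.add_apply, Pi.smul_apply, Pi.sub_apply, smul_eq_mul, mul_sub]
        rcases eq_or_ne w 0 with rfl | hw
        · rw [Pi.single_eq_same]
          linarith [ht.2]
        · rw [Pi.single_eq_of_ne hw]
          linarith [hq.1 w]
      · simp [p, Finset.sum_add_distrib, ← Finset.mul_sum, hq.2]
  have : (nhdsWithin (0 : ℝ) (Set.Ioo 0 (q 0))).NeBot := by
    rw [nhdsWithin_Ioo_eq_nhdsGT hq0]
    infer_instance
  obtain ⟨t, hle, ht⟩ := ((hp0.eventually hmin).and self_mem_nhdsWithin).exists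
  have hlt : ε ^ ((n : ℝ) * t) < 1 :=
    Real.rpow_lt_one hε0.le hε1 (mul_pos hn0 ht.1)
  simp only [p, eqLoss_add_smul hε0] at hle
  nlinarith [mul_pos (sub_pos.2 hlt) hD]
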